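/- Let {M_{a|x}}, x = 1, …, m, be a measurement assemblage on ℂ^d consisting of m POVMs. Then τ̄({M_{a|x}}) ≤ m(d − 1), with equality if and only if every M_{a|x} has rank 1 and the POVMs are pairwise mutually orthogonal, i.e., tr(M̄_{a|x} M̄_{b|y}) = 0 for all x ≠ y and all a, b, where X̄ = X − (tr(X)/d)·I. Likewise, any state assemblage {ρ_{a|x}} with m ensembles for a matrix ρ_B with tr(ρ_B) = 1 satisfies τ̄({ρ_{a|x}}) ≤ m(1 − 1/d), with equality if and only if every ρ_{a|x} has rank 1 and the ensembles are pairwise mutually orthogonal (tr(ρ̄_{a|x} ρ̄_{b|y}) = 0 for all x ≠ y and all a, b). -/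

import Mathlib

open ComplexOrder Matrix

/-- Quadratic form of the superoperator `G({ρ_a})`:
`⟨C, G({ρ_a}) C⟩ = Σ_a (tr(ρ_a C))²/tr(ρ_a)`. -/
noncomputable def qG {d n : ℕ} (ρ : Fin n → Matrix (Fin d) (Fin d) ℂ)
    (C : Matrix (Fin d) (Fin d) ℂ) : ℝ :=
  ∑ a, ((ρ a * C).trace.re) ^ 2 / (ρ a).trace.re

/-- The traceless part of a matrix: `X̄ = X − (tr(X)/d)·I`. -/
noncomputable def matBar {d : ℕ} (X : Matrix (Fin d) (Fin d) ℂ) :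
    Matrix (Fin d) (Fin d) ℂ :=
  X - (X.trace / (d : ℂ)) • (1 : Matrix (Fin d) (Fin d) ℂ)

/-- Quadratic form of the superoperator `Ḡ({ρ_a})`:
`⟨C, Ḡ({ρ_a}) C⟩ = Σ_a (tr(ρ̄_a C))²/tr(ρ_a)`. -/
noncomputable def qGbar {d n : ℕ} (ρ : Fin n → Matrix (Fin d) (Fin d) ℂ)
    (C : Matrix (Fin d) (Fin d) ℂ) : ℝ :=
  ∑ a, ((matBar (ρ a) * C).trace.re) ^ 2 / (ρ a).trace.re

/-- Given, for each index `x`, the quadratic form `C ↦ ⟨C, G_x C⟩` of a superoperator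
`G_x` on Hermitian matrices, `tauGen` is the infimum of `Tr(F)` over all self-adjoint
linear endomorphisms `F` of the real inner product space of Hermitian matrices
(inner product `⟨X,Y⟩ = tr(XY)`) satisfying `F ≥ G_x` for every `x`. -/
noncomputable def tauGen {d : ℕ} {ι : Type} (q : ι → Matrix (Fin d) (Fin d) ℂ → ℝ) : ℝ :=
  sInf { t : ℝ |
    ∃ F : selfAdjoint (Matrix (Fin d) (Fin d) ℂ) →ₗ[ℝ] selfAdjoint (Matrix (Fin d) (Fin d) ℂ),
      (∀ X Y : selfAdjoint (Matrix (Fin d) (Fin d) ℂ),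
        ((X : Matrix (Fin d) (Fin d) ℂ) * (F Y : Matrix (Fin d) (Fin d) ℂ)).trace.re
          = ((F X : Matrix (Fin d) (Fin d) ℂ) * (Y : Matrix (Fin d) (Fin d) ℂ)).trace.re) ∧
      (∀ (x : ι) (C : selfAdjoint (Matrix (Fin d) (Fin d) ℂ)),
        q x (C : Matrix (Fin d) (Fin d) ℂ)
          ≤ ((C : Matrix (Fin d) (Fin d) ℂ) * (F C : Matrix (Fin d) (Fin d) ℂ)).trace.re) ∧
      LinearMap.trace ℝ (selfAdjoint (Matrix (Fin d) (Fin d) ℂ)) F = t }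

/-- `τ({ρ_{a|x}}) = inf{Tr(F) : F self-adjoint, F ≥ G({ρ_{a|x}}_a) for all x}`. -/
noncomputable def tau {d m : ℕ} {n : Fin m → ℕ}
    (ρ : ∀ x, Fin (n x) → Matrix (Fin d) (Fin d) ℂ) : ℝ :=
  tauGen (fun x => qG (ρ x))

/-- `τ̄({ρ_{a|x}}) = inf{Tr(F) : F self-adjoint, F ≥ Ḡ({ρ_{a|x}}_a) for all x}`. -/
noncomputable def tauBar {d m : ℕ} {n : Fin m → ℕ}
    (ρ : ∀ x, Fin (n x) → Matrix (Fin d) (Fin d) ℂ) : ℝ :=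
  tauGen (fun x => qGbar (ρ x))

section DominatingOperators

variable {E : Type*} [NormedAddCommGroup E] [InnerProductSpace ℝ E]

theorem LinearMap.IsPositive.conj_of_isSymmetric {T S : E →ₗ[ℝ] E} (hT : T.IsPositive)
    (hS : S.IsSymmetric) : (S * T * S).IsPositive := by
  refine ⟨fun u v => ?_, fun u => ?_⟩
  · simp only [Module.End.mul_apply]
    rw [hS, hT.isSymmetric, hS]
  · simp only [Module.End.mul_apply]
    rw [hS]
    exact hT.2 _

theorem LinearMap.IsPositive.trace_mul_nonneg {T P : E →ₗ[ℝ] E} (hT : T.IsPositive)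
    (hP : P.IsSymmetric) (hPP : P * P = P) : 0 ≤ LinearMap.trace ℝ E (T * P) := by
  have h := (hT.conj_of_isSymmetric hP).trace_nonneg
  rwa [LinearMap.trace_mul_comm, ← mul_assoc, hPP, LinearMap.trace_mul_comm] at h

/-- Any common upper bound of positive operators with pairwise vanishing products has trace at
least the sum of their traces. -/
theorem sum_trace_le_trace_of_mul_eq_zero [FiniteDimensional ℝ E] {ι : Type*} [Fintype ι] [Nonempty ι]
    {G : ι → E →ₗ[ℝ] E} (hG : ∀ x, (G x).IsPositive) (horth : ∀ x y, x ≠ y → G x * G y = 0)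
    {F : E →ₗ[ℝ] E} (hF : ∀ x, (F - G x).IsPositive) :
    ∑ x, LinearMap.trace ℝ E (G x) ≤ LinearMap.trace ℝ E F := by
  classical
  let P : ι → E →ₗ[ℝ] E := fun x => (LinearMap.range (G x)).starProjection.toLinearMap
  have hPs : ∀ x, (P x).IsSymmetric := fun x => Submodule.starProjection_isSymmetric _
  have hPG : ∀ x, P x * G x = G x := fun x => LinearMap.ext fun u =>
    Submodule.starProjection_eq_self_iff.mpr ⟨u, rfl⟩
  have hPP : ∀ x, P x * P x = P x := fun x => LinearMap.ext fun u =>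
    Submodule.starProjection_eq_self_iff.mpr (Submodule.starProjection_apply_mem _ u)
  have hPxy : ∀ x y, x ≠ y → P x * P y = 0 := by
    intro x y hxy
    ext u
    refine Submodule.eq_starProjection_of_mem_orthogonal (zero_mem _) ?_
    rw [LinearMap.zero_apply, sub_zero]
    obtain ⟨w, hw⟩ : P y u ∈ LinearMap.range (G y) := Submodule.starProjection_apply_mem _ u
    rw [← hw, Submodule.mem_orthogonal]
    rintro _ ⟨z, rfl⟩
    rw [(hG x).isSymmetric, ← Module.End.mul_apply, horth x y hxy]
    simp
  have hQs : (1 - ∑ x, P x).IsSymmetric :=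
    LinearMap.IsSymmetric.id.sub (by
      intro u v
      simp only [LinearMap.sum_apply, sum_inner, inner_sum, hPs _ u v])
  have hSS : (∑ x, P x) * (∑ x, P x) = ∑ x, P x := by
    rw [Finset.sum_mul_sum]
    refine Finset.sum_congr rfl fun x _ => ?_
    rw [Finset.sum_eq_single x (fun y _ hy => hPxy x y hy.symm) (by simp), hPP]
  have hQQ : (1 - ∑ x, P x) * (1 - ∑ x, P x) = 1 - ∑ x, P x := by
    rw [mul_sub, sub_mul, sub_mul, hSS]; simp
  have hFpos : F.IsPositive := by
    obtain ⟨x⟩ := ‹Nonempty ι›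
    simpa using (hF x).add (hG x)
  have h1 := hFpos.trace_mul_nonneg hQs hQQ
  rw [mul_sub, Finset.mul_sum, map_sub, map_sum, mul_one] at h1
  have h2 : ∑ x, LinearMap.trace ℝ E (G x) ≤ ∑ x, LinearMap.trace ℝ E (F * P x) := by
    refine Finset.sum_le_sum fun x _ => ?_
    have h3 := (hF x).trace_mul_nonneg (hPs x) (hPP x)
    rw [sub_mul, map_sub, LinearMap.trace_mul_comm ℝ (G x), hPG] at h3
    linarith
  linarith

/-- Two positive operators `A`, `B` admit a common upper bound of trace at most
`tr A + tr B - (2 ε tr(AB) - O(ε²))`. -/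
theorem isPositive_sub_overlap {A B : E →ₗ[ℝ] E} (hA : A.IsPositive) (hB : B.IsPositive)
    (ε : ℝ) :
    (A - (ε • (A * B + B * A) - ε ^ 2 • (B * A * B + A * B * A))).IsPositive := by
  have hS : (1 - ε • B).IsSymmetric := LinearMap.IsSymmetric.id.sub (hB.isSymmetric.smul (by simp))
  have h1 := hA.conj_of_isSymmetric hS
  have h2 := (hB.conj_of_isSymmetric hA.isSymmetric).smul_of_nonneg (sq_nonneg ε)
  convert h1.add h2 using 1
  simp only [mul_sub, sub_mul, smul_sub, smul_add, mul_one, one_mul, smul_mul_assoc,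
    mul_smul_comm, smul_smul, pow_two, mul_assoc]
  abel

/-- If the sum of positive operators has minimal trace among their common upper bounds, then the
operators are pairwise orthogonal. -/
theorem trace_mul_nonpos_of_sum_trace_le [FiniteDimensional ℝ E] {ι : Type*} [Fintype ι]
    {G : ι → E →ₗ[ℝ] E} (hG : ∀ x, (G x).IsPositive)
    (hmin : ∀ F : E →ₗ[ℝ] E, (∀ x, (F - G x).IsPositive) →
      ∑ x, LinearMap.trace ℝ E (G x) ≤ LinearMap.trace ℝ E F)
    {x y : ι} (hxy : x ≠ y) : LinearMap.trace ℝ E (G x * G y) ≤ 0 := by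
  classical
  set A := G x with hA
  set B := G y with hB
  set t := LinearMap.trace ℝ E (A * B) with ht
  set c := LinearMap.trace ℝ E (B * A * B + A * B * A) with hc
  have key : ∀ ε : ℝ, 2 * ε * t ≤ ε ^ 2 * c := by
    intro ε
    set K := ε • (A * B + B * A) - ε ^ 2 • (B * A * B + A * B * A) with hK
    have hAK : (A - K).IsPositive := isPositive_sub_overlap (hG x) (hG y) ε
    have hBK : (B - K).IsPositive := by
      have := isPositive_sub_overlap (hG y) (hG x) ε
      rwa [add_comm (G y * G x), add_comm (G x * G y * G x)] at this
    have hrest : ∀ s : Finset ι, (∑ z ∈ s, G z).IsPositive := fun s =>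
      LinearMap.isPositive_sum s fun z _ => hG z
    have hsplit : ∀ z, ∑ w, G w = G z + ∑ w ∈ Finset.univ.erase z, G w := fun z =>
      (Finset.add_sum_erase _ _ (Finset.mem_univ z)).symm
    have h := hmin (∑ z, G z - K) (by
      intro z
      by_cases hzx : z = x
      · have h' : (∑ w, G w - K - G z) = (B - K) + ∑ w ∈ (Finset.univ.erase x).erase y, G w := by
          rw [hsplit x, ← Finset.add_sum_erase _ _
            (Finset.mem_erase.mpr ⟨hxy.symm, Finset.mem_univ y⟩), hzx]
          abel
        rw [h']
        exact hBK.add (hrest _)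
      · have h' : (∑ w, G w - K - G z) = (A - K) + ∑ w ∈ (Finset.univ.erase z).erase x, G w := by
          rw [hsplit z, ← Finset.add_sum_erase _ _
            (Finset.mem_erase.mpr ⟨Ne.symm hzx, Finset.mem_univ x⟩)]
          abel
        rw [h']
        exact hAK.add (hrest _))
    rw [map_sub, map_sum, hK, map_sub, map_smul, map_smul, map_add,
      LinearMap.trace_mul_comm ℝ B A, ← hc, ← ht, smul_eq_mul, smul_eq_mul] at h
    linarith
  by_contra! hpos
  have hc1 : 0 < |c| + 1 := by positivity
  have h := key (t / (|c| + 1))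
  have h3 : (t / (|c| + 1)) ^ 2 * c ≤ (t / (|c| + 1)) * t := by
    rw [pow_two, mul_assoc]
    refine mul_le_mul_of_nonneg_left ?_ (by positivity)
    rw [div_mul_eq_mul_div, div_le_iff₀ hc1]
    nlinarith [le_abs_self c]
  have h4 : 0 < (t / (|c| + 1)) * t := by positivity
  linarith

/-- The sum of squares `C ↦ ∑ a, ⟪v a, C⟫² / r a` as a self-adjoint operator. -/
noncomputable def frameOperator {n : ℕ} (v : Fin n → E) (r : Fin n → ℝ) : E →ₗ[ℝ] E :=
  ∑ a, (r a)⁻¹ • ((innerₗ E (v a)).smulRight (v a))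

theorem frameOperator_apply {n : ℕ} (v : Fin n → E) (r : Fin n → ℝ) (C : E) :
    frameOperator v r C = ∑ a, (r a)⁻¹ • (inner ℝ (v a) C • v a) := by
  simp [frameOperator]

theorem inner_frameOperator {n : ℕ} (v : Fin n → E) (r : Fin n → ℝ) (C : E) :
    inner ℝ C (frameOperator v r C) = ∑ a, (inner ℝ (v a) C) ^ 2 / r a := by
  rw [frameOperator_apply, inner_sum]
  refine Finset.sum_congr rfl fun a _ => ?_
  rw [inner_smul_right, inner_smul_right, real_inner_comm C (v a)]
  ring

theorem frameOperator_isPositive {n : ℕ} (v : Fin n → E) {r : Fin n → ℝ} (hr : ∀ a, 0 < r a) :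
    (frameOperator v r).IsPositive := by
  refine ⟨fun C D => ?_, fun C => ?_⟩
  · simp only [frameOperator_apply, sum_inner, inner_sum, inner_smul_right, real_inner_smul_left]
    refine Finset.sum_congr rfl fun a _ => ?_
    rw [real_inner_comm C (v a)]
    ring
  · rw [real_inner_comm, inner_frameOperator]
    simpa using Finset.sum_nonneg fun a _ => div_nonneg (sq_nonneg (inner ℝ (v a) C)) (hr a).le

theorem trace_frameOperator [FiniteDimensional ℝ E] {n : ℕ} (v : Fin n → E) (r : Fin n → ℝ) :
    LinearMap.trace ℝ E (frameOperator v r) = ∑ a, inner ℝ (v a) (v a) / r a := by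
  simp [frameOperator, LinearMap.trace_smulRight, div_eq_inv_mul]

theorem trace_frameOperator_mul [FiniteDimensional ℝ E] {n k : ℕ} (v : Fin n → E) (r : Fin n → ℝ) (w : Fin k → E)
    (s : Fin k → ℝ) :
    LinearMap.trace ℝ E (frameOperator v r * frameOperator w s)
      = ∑ a, ∑ b, (inner ℝ (v a) (w b)) ^ 2 / (r a * s b) := by
  have h : ∀ a, ((innerₗ E (v a)).smulRight (v a)) * frameOperator w s
      = ((innerₗ E (v a)).comp (frameOperator w s)).smulRight (v a) := fun a => by ext; simp
  simp only [frameOperator.eq_def v r, Finset.sum_mul, smul_mul_assoc, map_sum, map_smul, h]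
  refine Finset.sum_congr rfl fun a _ => ?_
  simp only [LinearMap.trace_smulRight, LinearMap.comp_apply, innerₗ_apply_apply,
    inner_frameOperator, smul_eq_mul, Finset.mul_sum]
  refine Finset.sum_congr rfl fun b _ => ?_
  rw [real_inner_comm (v a) (w b)]
  field_simp

theorem sInf_trace_dominating [FiniteDimensional ℝ E] {m : ℕ} [Nonempty (Fin m)] {n : Fin m → ℕ}
    (v : ∀ x, Fin (n x) → E) (r : ∀ x, Fin (n x) → ℝ) (hr : ∀ x a, 0 < r x a) :
    let S := {t : ℝ | ∃ F : E →ₗ[ℝ] E, (∀ X Y, inner ℝ X (F Y) = inner ℝ (F X) Y) ∧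
      (∀ x C, ∑ a, (inner ℝ (v x a) C) ^ 2 / r x a ≤ inner ℝ C (F C)) ∧
      LinearMap.trace ℝ E F = t}
    let T := ∑ x, ∑ a, inner ℝ (v x a) (v x a) / r x a
    sInf S ≤ T ∧ (sInf S = T ↔ ∀ x y, x ≠ y → ∀ a b, inner ℝ (v x a) (v y b) = 0) := by
  intro S T
  let G : Fin m → E →ₗ[ℝ] E := fun x => frameOperator (v x) (r x)
  have hG : ∀ x, (G x).IsPositive := fun x => frameOperator_isPositive (v x) (hr x)
  have hT : T = ∑ x, LinearMap.trace ℝ E (G x) := by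
    simp only [T, G, trace_frameOperator]
  have hS : S = {t | ∃ F : E →ₗ[ℝ] E, (∀ x, (F - G x).IsPositive) ∧
      LinearMap.trace ℝ E F = t} := by
    ext t
    refine exists_congr fun F => ?_
    rw [← and_assoc]
    refine and_congr_left fun _ => ⟨fun h x => ⟨fun X Y => ?_, fun C => ?_⟩, fun h => ⟨?_, ?_⟩⟩
    · simp only [LinearMap.sub_apply, inner_sub_left, inner_sub_right, h.1,
        (hG x).isSymmetric X Y]
    · have := h.2 x C
      rw [← inner_frameOperator] at this
      rw [real_inner_comm, LinearMap.sub_apply, inner_sub_right]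
      simpa using this
    · obtain ⟨x⟩ := ‹Nonempty (Fin m)›
      have := ((h x).add (hG x)).isSymmetric
      rw [sub_add_cancel] at this
      exact fun X Y => (this X Y).symm
    · intro x C
      have := (h x).2 C
      rw [real_inner_comm, LinearMap.sub_apply, inner_sub_right] at this
      rw [← inner_frameOperator]
      simpa using this
  have hbdd : BddBelow S := by
    refine ⟨0, ?_⟩
    rw [hS]
    rintro _ ⟨F, hF, rfl⟩
    obtain ⟨x⟩ := ‹Nonempty (Fin m)›
    simpa using ((hF x).add (hG x)).trace_nonneg
  have hTS : T ∈ S := by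
    rw [hS]
    refine ⟨∑ x, G x, fun x => ?_, by rw [map_sum, hT]⟩
    rw [← Finset.add_sum_erase _ _ (Finset.mem_univ x), add_sub_cancel_left]
    exact LinearMap.isPositive_sum _ fun z _ => hG z
  refine ⟨csInf_le hbdd hTS, fun h x y hxy a b => ?_, fun h => ?_⟩
  · have h1 := trace_mul_nonpos_of_sum_trace_le hG (fun F hF => by
      rw [← hT, ← h]
      exact csInf_le hbdd (by rw [hS]; exact ⟨F, hF, rfl⟩)) hxy
    have hnn : ∀ a b, 0 ≤ (inner ℝ (v x a) (v y b)) ^ 2 / (r x a * r y b) := fun a b =>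
      div_nonneg (sq_nonneg _) (mul_pos (hr x a) (hr y b)).le
    rw [trace_frameOperator_mul] at h1
    have h2 := le_antisymm h1 (Finset.sum_nonneg fun a _ => Finset.sum_nonneg fun b _ => hnn a b)
    rw [Finset.sum_eq_zero_iff_of_nonneg
      fun a _ => Finset.sum_nonneg fun b _ => hnn a b] at h2
    have h3 := h2 a (Finset.mem_univ a)
    rw [Finset.sum_eq_zero_iff_of_nonneg fun b _ => hnn a b] at h3
    have h4 := h3 b (Finset.mem_univ b)
    rw [div_eq_zero_iff] at h4
    have h5 := (mul_pos (hr x a) (hr y b)).ne'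
    simpa [h5] using h4
  · refine le_antisymm (csInf_le hbdd hTS) (le_csInf ⟨T, hTS⟩ ?_)
    rw [hS, hT]
    rintro _ ⟨F, hF, rfl⟩
    refine sum_trace_le_trace_of_mul_eq_zero hG (fun x y hxy => LinearMap.ext fun C => ?_) hF
    simp only [G, Module.End.mul_apply, frameOperator_apply, inner_sum, inner_smul_right,
      h x y hxy, mul_zero, Finset.sum_const_zero, zero_smul, smul_zero, LinearMap.zero_apply]

end DominatingOperators

namespace Matrix.PosSemidef

variable {d : ℕ} {A : Matrix (Fin d) (Fin d) ℂ}

theorem trace_mul_self_eq_sum_eigenvalues (hA : A.IsHermitian) :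
    (A * A).trace.re = ∑ i, hA.eigenvalues i ^ 2 := by
  have h := hA.spectral_theorem
  have h2 : A * A = Unitary.conjStarAlgAut ℂ _ hA.eigenvectorUnitary
      (diagonal (RCLike.ofReal ∘ hA.eigenvalues) * diagonal (RCLike.ofReal ∘ hA.eigenvalues)) := by
    rw [map_mul, ← h]
  rw [h2, Unitary.conjStarAlgAut_apply, trace_mul_comm, ← mul_assoc]
  simp [diagonal_mul_diagonal, trace_diagonal, pow_two]

theorem trace_mul_self_le_and_eq_iff (hA : A.PosSemidef) (h0 : A ≠ 0) :
    (A * A).trace.re ≤ A.trace.re ^ 2 ∧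
      ((A * A).trace.re = A.trace.re ^ 2 ↔ A.rank = 1) := by
  have hH := hA.isHermitian
  set l := hH.eigenvalues with hl
  have hl0 : ∀ i, 0 ≤ l i := hA.eigenvalues_nonneg
  have ht : A.trace.re = ∑ i, l i := by
    rw [hH.trace_eq_sum_eigenvalues]; simp [hl]
  have hdiff : A.trace.re ^ 2 - (A * A).trace.re
      = ∑ i, ∑ j ∈ Finset.univ.erase i, l i * l j := by
    rw [ht, trace_mul_self_eq_sum_eigenvalues hH, pow_two, Finset.sum_mul_sum,
      ← Finset.sum_sub_distrib]
    refine Finset.sum_congr rfl fun i _ => ?_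
    rw [← Finset.add_sum_erase _ _ (Finset.mem_univ i)]
    ring
  have hnn : ∀ i, 0 ≤ ∑ j ∈ Finset.univ.erase i, l i * l j := fun i =>
    Finset.sum_nonneg fun j _ => mul_nonneg (hl0 i) (hl0 j)
  have hle : (A * A).trace.re ≤ A.trace.re ^ 2 := by
    rw [← sub_nonneg, hdiff]; exact Finset.sum_nonneg fun i _ => hnn i
  obtain ⟨k, hk⟩ : ∃ k, l k ≠ 0 := by
    by_contra! h
    exact h0 (hH.eigenvalues_eq_zero_iff.mp (funext h))
  refine ⟨hle, ?_⟩
  have h1 : (A * A).trace.re = A.trace.re ^ 2 ↔ ∀ i j, j ≠ i → l i * l j = 0 := by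
    rw [eq_comm, ← sub_eq_zero, hdiff, Finset.sum_eq_zero_iff_of_nonneg fun i _ => hnn i]
    refine ⟨fun h i j hij => ?_, fun h i _ => Finset.sum_eq_zero fun j hj =>
      h i j (Finset.ne_of_mem_erase hj)⟩
    have := h i (Finset.mem_univ i)
    rw [Finset.sum_eq_zero_iff_of_nonneg fun j _ => mul_nonneg (hl0 i) (hl0 j)] at this
    exact this j (Finset.mem_erase.mpr ⟨hij, Finset.mem_univ j⟩)
  rw [h1, hH.rank_eq_card_non_zero_eigs, Fintype.card_eq_one_iff]
  constructor
  · intro h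
    refine ⟨⟨k, hk⟩, fun ⟨j, hj⟩ => Subtype.ext ?_⟩
    by_contra hjk
    exact (mul_ne_zero hk hj) (h k j hjk)
  · rintro ⟨k', hk'⟩ i j hij
    by_contra hne
    obtain ⟨hi, hj⟩ := mul_ne_zero_iff.mp hne
    have e1 := hk' ⟨i, hi⟩
    have e2 := hk' ⟨j, hj⟩
    exact hij (congrArg Subtype.val (e2.trans e1.symm))

end Matrix.PosSemidef

section HermitianMatrices

variable {d : ℕ}

theorem Matrix.IsHermitian.im_trace_mul_eq_zero {A B : Matrix (Fin d) (Fin d) ℂ}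
    (hA : A.IsHermitian) (hB : B.IsHermitian) : (A * B).trace.im = 0 := by
  have h : star (A * B).trace = (A * B).trace := by
    rw [← trace_conjTranspose, conjTranspose_mul, hA.eq, hB.eq, trace_mul_comm]
  exact Complex.conj_eq_iff_im.mp h

/-- The Hilbert–Schmidt inner product `⟨X, Y⟩ = tr(XY)` on Hermitian matrices. -/
noncomputable abbrev hermitianCore (d : ℕ) :
    InnerProductSpace.Core ℝ (selfAdjoint (Matrix (Fin d) (Fin d) ℂ)) where
  inner X Y := ((X : Matrix (Fin d) (Fin d) ℂ) * (Y : Matrix (Fin d) (Fin d) ℂ)).trace.re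
  conj_inner_symm X Y := congrArg Complex.re (trace_mul_comm _ _)
  re_inner_nonneg X := by
    have h := (posSemidef_conjTranspose_mul_self (X : Matrix (Fin d) (Fin d) ℂ)).trace_nonneg
    rw [show (X : Matrix (Fin d) (Fin d) ℂ)ᴴ = X from X.2] at h
    exact (Complex.le_def.mp h).1
  add_left X Y Z := by simp [add_mul]
  smul_left X Y r := by simp
  definite X h := by
    have hX : (X : Matrix (Fin d) (Fin d) ℂ)ᴴ = X := X.2
    have him := Matrix.IsHermitian.im_trace_mul_eq_zero (A := X.1) (B := X.1) X.2 X.2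
    have h0 : ((X : Matrix (Fin d) (Fin d) ℂ)ᴴ * (X : Matrix (Fin d) (Fin d) ℂ)).trace = 0 := by
      rw [hX]
      exact Complex.ext h him
    exact Subtype.ext (trace_conjTranspose_mul_self_eq_zero_iff.mp h0)

instance : FiniteDimensional ℝ (selfAdjoint (Matrix (Fin d) (Fin d) ℂ)) :=
  FiniteDimensional.of_injective
    (selfAdjoint.submodule ℝ (Matrix (Fin d) (Fin d) ℂ)).subtype Subtype.val_injective

theorem Matrix.IsHermitian.matBar {X : Matrix (Fin d) (Fin d) ℂ} (hX : X.IsHermitian) :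
    (matBar X).IsHermitian := by
  have ht : star X.trace = X.trace := by rw [← trace_conjTranspose, hX.eq]
  simp only [Matrix.IsHermitian, _root_.matBar, conjTranspose_sub, conjTranspose_smul,
    conjTranspose_one, hX.eq, star_div₀, ht, star_natCast]

theorem trace_matBar_mul_self (hd : 1 ≤ d) (X : Matrix (Fin d) (Fin d) ℂ) :
    (matBar X * matBar X).trace = (X * X).trace - X.trace ^ 2 / d := by
  have hd' : (d : ℂ) ≠ 0 := by exact_mod_cast (by omega : d ≠ 0)
  simp only [matBar, sub_mul, mul_sub, trace_sub, smul_mul_assoc, mul_smul_comm, one_mul, mul_one,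
    trace_smul, trace_one, smul_eq_mul, Fintype.card_fin]
  field_simp
  ring

theorem tauBar_le_and_eq_iff_orthogonal {m : ℕ} [Nonempty (Fin m)] {n : Fin m → ℕ}
    (ρ : ∀ x : Fin m, Fin (n x) → Matrix (Fin d) (Fin d) ℂ)
    (hherm : ∀ x a, (ρ x a).IsHermitian) (hpos : ∀ x a, 0 < (ρ x a).trace.re) :
    let T := ∑ x, ∑ a, (matBar (ρ x a) * matBar (ρ x a)).trace.re / (ρ x a).trace.re
    tauBar ρ ≤ T ∧ (tauBar ρ = T ↔
      ∀ x y, x ≠ y → ∀ a b, (matBar (ρ x a) * matBar (ρ y b)).trace = 0) := by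
  let _ := hermitianCore d
  let : NormedAddCommGroup (selfAdjoint (Matrix (Fin d) (Fin d) ℂ)) :=
    InnerProductSpace.Core.toNormedAddCommGroup (𝕜 := ℝ)
  let : InnerProductSpace ℝ (selfAdjoint (Matrix (Fin d) (Fin d) ℂ)) :=
    InnerProductSpace.ofCore (hermitianCore d).toCore
  have h := sInf_trace_dominating
    (fun x a => (⟨matBar (ρ x a), (hherm x a).matBar⟩ :
      selfAdjoint (Matrix (Fin d) (Fin d) ℂ)))
    (fun x a => (ρ x a).trace.re) hpos
  refine ⟨h.1, h.2.trans ?_⟩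
  refine forall_congr' fun x => forall_congr' fun y => imp_congr_right fun _ =>
    forall_congr' fun a => forall_congr' fun b => ⟨fun h' => Complex.ext h'
      ((hherm x a).matBar.im_trace_mul_eq_zero (hherm y b).matBar), fun h' => ?_⟩
  exact congrArg Complex.re h'

theorem Matrix.PosSemidef.trace_re_pos {A : Matrix (Fin d) (Fin d) ℂ} (hA : A.PosSemidef)
    (h0 : A ≠ 0) : 0 < A.trace.re := by
  have h := Complex.le_def.mp hA.trace_nonneg
  refine lt_of_le_of_ne h.1 fun h' => h0 (hA.trace_eq_zero_iff.mp (Complex.ext h'.symm h.2.symm))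

theorem trace_matBar_mul_self_div_le_and_eq_iff (hd : 1 ≤ d) {A : Matrix (Fin d) (Fin d) ℂ}
    (hA : A.PosSemidef) (h0 : A ≠ 0) :
    (matBar A * matBar A).trace.re / A.trace.re ≤ A.trace.re * (1 - 1 / (d : ℝ)) ∧
      ((matBar A * matBar A).trace.re / A.trace.re = A.trace.re * (1 - 1 / (d : ℝ)) ↔
        A.rank = 1) := by
  have hpos := hA.trace_re_pos h0
  have him : A.trace.im = 0 := (Complex.le_def.mp hA.trace_nonneg).2.symm
  have hre : (matBar A * matBar A).trace.re = (A * A).trace.re - A.trace.re ^ 2 / d := by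
    have : A.trace = (A.trace.re : ℂ) := Complex.ext rfl (by simpa using him)
    rw [trace_matBar_mul_self hd, this]
    norm_cast
  have hR : A.trace.re * (1 - 1 / (d : ℝ)) * A.trace.re = A.trace.re ^ 2 - A.trace.re ^ 2 / d := by
    ring
  obtain ⟨h1, h2⟩ := hA.trace_mul_self_le_and_eq_iff h0
  rw [div_le_iff₀ hpos, div_eq_iff hpos.ne', hre, hR, ← h2, sub_left_inj]
  exact ⟨by linarith, Iff.rfl⟩

theorem tauBar_le_and_eq_iff_of_trace_eq {m : ℕ} (hd : 1 ≤ d) {n : Fin m → ℕ}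
    (ρ : ∀ x : Fin m, Fin (n x) → Matrix (Fin d) (Fin d) ℂ)
    (hpsd : ∀ x a, (ρ x a).PosSemidef) (h0 : ∀ x a, ρ x a ≠ 0)
    {s : ℝ} (hs : ∀ x, (∑ a, ρ x a).trace.re = s) :
    tauBar ρ ≤ m * (s * (1 - 1 / (d : ℝ))) ∧
      (tauBar ρ = m * (s * (1 - 1 / (d : ℝ))) ↔
        (∀ x a, (ρ x a).rank = 1) ∧
        (∀ x y, x ≠ y → ∀ a b, (matBar (ρ x a) * matBar (ρ y b)).trace = 0)) := by
  rcases Nat.eq_zero_or_pos m with rfl | hm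
  · have huniv : tauBar ρ = 0 := by
      unfold tauBar tauGen
      convert Real.sInf_univ
      refine Set.eq_univ_of_forall fun t => ?_
      have : Nonempty (Fin d) := ⟨⟨0, hd⟩⟩
      have hne : Nontrivial (selfAdjoint (Matrix (Fin d) (Fin d) ℂ)) :=
        ⟨⟨0, 1, fun h => zero_ne_one (congrArg Subtype.val h)⟩⟩
      have hfr : (Module.finrank ℝ (selfAdjoint (Matrix (Fin d) (Fin d) ℂ)) : ℝ) ≠ 0 := by
        exact_mod_cast Module.finrank_pos.ne'
      refine ⟨(t / Module.finrank ℝ (selfAdjoint (Matrix (Fin d) (Fin d) ℂ))) • LinearMap.id,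
        fun X Y => by simp, fun x => x.elim0, ?_⟩
      rw [map_smul, LinearMap.trace_id, smul_eq_mul, div_mul_cancel₀ _ hfr]
    simp [huniv]
  · have : Nonempty (Fin m) := ⟨⟨0, hm⟩⟩
    obtain ⟨h1, h2⟩ := tauBar_le_and_eq_iff_orthogonal ρ (fun x a => (hpsd x a).isHermitian)
      fun x a => (hpsd x a).trace_re_pos (h0 x a)
    have hbound : (m : ℝ) * (s * (1 - 1 / (d : ℝ)))
        = ∑ x, ∑ a, (ρ x a).trace.re * (1 - 1 / (d : ℝ)) := by
      simp only [← Finset.sum_mul, ← Complex.re_sum, ← trace_sum, hs]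
      simp [mul_assoc]
    have hrank := fun x a => trace_matBar_mul_self_div_le_and_eq_iff hd (hpsd x a) (h0 x a)
    have hle : ∀ x, ∑ a, (matBar (ρ x a) * matBar (ρ x a)).trace.re / (ρ x a).trace.re
        ≤ ∑ a, (ρ x a).trace.re * (1 - 1 / (d : ℝ)) := fun x =>
      Finset.sum_le_sum fun a _ => (hrank x a).1
    have hsum_le := Finset.sum_le_sum fun x (_ : x ∈ Finset.univ) => hle x
    have hsum_eq : ∑ x, ∑ a, (matBar (ρ x a) * matBar (ρ x a)).trace.re / (ρ x a).trace.re
        = ∑ x, ∑ a, (ρ x a).trace.re * (1 - 1 / (d : ℝ)) ↔ ∀ x a, (ρ x a).rank = 1 := by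
      rw [Finset.sum_eq_sum_iff_of_le fun x _ => hle x]
      simp only [Finset.mem_univ, forall_const]
      refine forall_congr' fun x => ?_
      rw [Finset.sum_eq_sum_iff_of_le fun a _ => (hrank x a).1]
      simp only [Finset.mem_univ, forall_const, fun a => (hrank x a).2]
    rw [hbound, ← hsum_eq, ← h2]
    refine ⟨h1.trans hsum_le, fun h => ?_, fun h => h.2.trans h.1⟩
    have h3 := le_antisymm hsum_le (h ▸ h1)
    exact ⟨h3, h.trans h3.symm⟩

end HermitianMatrices

/-- For an assemblage with `m` members: a measurement assemblage (`ρ_B = I`) satisfies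
`τ̄ ≤ m(d−1)`, with equality iff all the `M_{a|x}` have rank 1 and the POVMs are pairwise
mutually orthogonal (`tr(M̄_{a|x} M̄_{b|y}) = 0` for `x ≠ y`); a state assemblage
(`tr(ρ_B) = 1`) satisfies `τ̄ ≤ m(1 − 1/d)`, with the analogous equality condition. -/
theorem tauBar_le_of_m_members {d m : ℕ} (hd : 1 ≤ d) {n : Fin m → ℕ}
    (ρ : ∀ x : Fin m, Fin (n x) → Matrix (Fin d) (Fin d) ℂ)
    (hpsd : ∀ x a, (ρ x a).PosSemidef) (h0 : ∀ x a, ρ x a ≠ 0)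
    (ρB : Matrix (Fin d) (Fin d) ℂ) (hsum : ∀ x, ∑ a, ρ x a = ρB) :
    (ρB = 1 →
      tauBar ρ ≤ m * ((d : ℝ) - 1) ∧
      (tauBar ρ = m * ((d : ℝ) - 1) ↔
        (∀ x a, (ρ x a).rank = 1) ∧
        (∀ x y, x ≠ y → ∀ a b, (matBar (ρ x a) * matBar (ρ y b)).trace = 0))) ∧
    (ρB.trace = 1 →
      tauBar ρ ≤ m * (1 - 1 / (d : ℝ)) ∧
      (tauBar ρ = m * (1 - 1 / (d : ℝ)) ↔
        (∀ x a, (ρ x a).rank = 1) ∧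
        (∀ x y, x ≠ y → ∀ a b, (matBar (ρ x a) * matBar (ρ y b)).trace = 0))) := by
  refine ⟨fun hB => ?_, fun hB => ?_⟩
  · have hd' : (d : ℝ) ≠ 0 := by exact_mod_cast (by omega : d ≠ 0)
    have h := tauBar_le_and_eq_iff_of_trace_eq hd ρ hpsd h0 (s := d) fun x => by
      rw [hsum, hB]; simp
    rwa [mul_sub, mul_one, mul_one_div_cancel hd'] at h
  · have h := tauBar_le_and_eq_iff_of_trace_eq hd ρ hpsd h0 (s := 1) fun x => by
      rw [hsum, hB]; simp
    rwa [one_mul] at h
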